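/- Let A_n be the set of coatoms of L_n and let x ∈ L_n with x ≠ [n]. If there is a subset S ⊆ A_n with x = ⋀_{s∈S} s, then μ_{L_n}(x, [n]) = (-1)^{|S|}; if x is not a meet of any subset of coatoms, then μ_{L_n}(x, [n]) = 0. -/

import Mathlib

open scoped Classical

/-- An arithmetic progression of integers: a finite set of the form
`{a, a+r, ..., a+(k-1)r}` with `a : ℤ`, `r ≥ 1` and `k ≥ 0` (so the empty set and all
singletons are arithmetic progressions). -/
def IsAP (s : Finset ℤ) : Prop :=
  ∃ (a r : ℤ) (k : ℕ), 1 ≤ r ∧ s = (Finset.range k).image (fun i => a + (i : ℤ) * r)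

/-- The number `p_{nk}` of arithmetic progressions of cardinality `k` contained in `{1,…,n}`. -/
noncomputable def numAP (n k : ℕ) : ℕ :=
  ((Finset.Icc (1:ℤ) (n:ℤ)).powerset.filter (fun s => IsAP s ∧ s.card = k)).card

/-- The Möbius function of the poset of arithmetic progressions ordered by inclusion,
defined by `μ(x,x) = 1` and `μ(x,y) = -∑_{x ≤ z < y} μ(x,z)`, where `z` ranges over
arithmetic progressions with `x ⊆ z ⊂ y`.  (For `x ⊆ y ⊆ {1,…,n}`, all arithmetic
progressions `z` with `x ⊆ z ⊂ y` automatically lie in `L_n`, so this is the Möbius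
function of any interval `[x, y]` of the lattice `L_n`.) -/
noncomputable def apMu (x y : Finset ℤ) : ℤ :=
  if x = y then 1
  else - ∑ z ∈ (y.powerset.filter (fun z => IsAP z ∧ x ⊆ z ∧ z ≠ y)).attach, apMu x z.1
termination_by y.card
decreasing_by
  rename_i z
  have hz := z.2
  rw [Finset.mem_filter, Finset.mem_powerset] at hz
  exact Finset.card_lt_card (lt_of_le_of_ne hz.1 hz.2.2.2)

/-- The join of `a` and `b` in the lattice of arithmetic progressions contained in `t`:
the intersection of all arithmetic progressions contained in `t` that contain `a ∪ b`,
i.e. the smallest such progression. -/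
noncomputable def apJoin (t a b : Finset ℤ) : Finset ℤ :=
  t.filter (fun v => ∀ z : Finset ℤ, IsAP z → z ⊆ t → a ∪ b ⊆ z → v ∈ z)

/-- The meet (intersection) of a finite family `S` of subsets of the top element `t`;
the meet of the empty family is `t` itself. -/
def apMeet (t : Finset ℤ) (S : Finset (Finset ℤ)) : Finset ℤ :=
  S.fold (· ⊓ ·) t id

/-- `x` is a coatom of the lattice `L_n` of arithmetic progressions contained in
`{1,…,n}`: an element distinct from the maximum `{1,…,n}` with no element strictly
between it and the maximum. -/
def IsCoatomIn (n : ℕ) (x : Finset ℤ) : Prop :=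
  IsAP x ∧ x ⊆ Finset.Icc (1:ℤ) (n:ℤ) ∧ x ≠ Finset.Icc (1:ℤ) (n:ℤ) ∧
    ∀ y : Finset ℤ, IsAP y → y ⊆ Finset.Icc (1:ℤ) (n:ℤ) → x ⊂ y → y = Finset.Icc (1:ℤ) (n:ℤ)

/-- `y` is covered by `top` in the poset of arithmetic progressions: `y < top` and there
is no arithmetic progression strictly between them. -/
def CoveredIn (top y : Finset ℤ) : Prop :=
  IsAP y ∧ y ⊂ top ∧ ¬ ∃ z : Finset ℤ, IsAP z ∧ y ⊂ z ∧ z ⊂ top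

/-- `c` is a maximal chain in the lattice `L_n` of arithmetic progressions contained
in `{1,…,n}`: a chain (under inclusion) of elements of `L_n` to which no further
element of `L_n` can be added. -/
def IsMaxChainIn (n : ℕ) (c : Finset (Finset ℤ)) : Prop :=
  (∀ s ∈ c, IsAP s ∧ s ⊆ Finset.Icc (1:ℤ) (n:ℤ)) ∧
  IsChain (· ⊆ ·) (↑c : Set (Finset ℤ)) ∧
  ∀ z : Finset ℤ, IsAP z → z ⊆ Finset.Icc (1:ℤ) (n:ℤ) →
    IsChain (· ⊆ ·) (insert z (↑c : Set (Finset ℤ))) → z ∈ c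

/-- The number `b_{nk}` of chains of length `k` (i.e. totally ordered subsets with `k+1`
elements) in `L_n` that contain both `∅` and `{1,…,n}`. -/
noncomputable def numChains (n k : ℕ) : ℕ :=
  (((Finset.Icc (1:ℤ) (n:ℤ)).powerset.filter IsAP).powerset.filter
    (fun c : Finset (Finset ℤ) => c.card = k + 1 ∧ ∅ ∈ c ∧ Finset.Icc (1:ℤ) (n:ℤ) ∈ c ∧
      IsChain (· ⊆ ·) (↑c : Set (Finset ℤ)))).card

theorem mem_apMeet {t : Finset ℤ} {S : Finset (Finset ℤ)} {v : ℤ} :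
    v ∈ apMeet t S ↔ v ∈ t ∧ ∀ s ∈ S, v ∈ s := by
  unfold apMeet
  induction S using Finset.induction_on with
  | empty => simp
  | insert a S ha ih =>
    rw [Finset.fold_insert ha, Finset.inf_eq_inter, Finset.mem_inter, ih]
    simp only [id, Finset.forall_mem_insert]
    tauto

theorem subset_apMeet {t w : Finset ℤ} {S : Finset (Finset ℤ)} :
    w ⊆ apMeet t S ↔ w ⊆ t ∧ ∀ s ∈ S, w ⊆ s := by
  simp only [Finset.subset_iff, mem_apMeet]
  grind

theorem isAP_iff {s : Finset ℤ} :
    IsAP s ↔ ∃ (a r : ℤ) (k : ℕ), 1 ≤ r ∧ ∀ v, v ∈ s ↔ ∃ i : ℕ, i < k ∧ a + (i : ℤ) * r = v := by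
  simp [IsAP, Finset.ext_iff]

theorem isAP_filter_dvd (a b d : ℤ) (hd : 1 ≤ d) :
    IsAP ((Finset.Icc a b).filter (fun v => d ∣ v - 1)) := by
  have hdm := Int.emod_add_mul_ediv (1 - a) d
  have h0 := Int.emod_nonneg (1 - a) (show d ≠ 0 by omega)
  have h1 := Int.emod_lt_of_pos (1 - a) (show 0 < d by omega)
  set q := (1 - a) / d
  set r := (1 - a) % d
  refine isAP_iff.2 ⟨1 - d * q, d, ((b - (1 - d * q)) / d + 1).toNat, hd, fun v => ?_⟩
  simp only [Finset.mem_filter, Finset.mem_Icc]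
  constructor
  · rintro ⟨⟨hav, hvb⟩, c, hc⟩
    have hnn : 0 ≤ c + q := by
      by_contra! h
      nlinarith
    refine ⟨(c + q).toNat, ?_, ?_⟩
    · have : c + q ≤ (b - (1 - d * q)) / d := by
        rw [Int.le_ediv_iff_mul_le (by omega)]
        nlinarith
      omega
    · rw [Int.toNat_of_nonneg hnn]
      linear_combination -hc
  · rintro ⟨i, hi, rfl⟩
    have hi' : (i : ℤ) ≤ (b - (1 - d * q)) / d := by omega
    rw [Int.le_ediv_iff_mul_le (by omega)] at hi'
    refine ⟨⟨?_, by linarith⟩, ⟨i - q, by ring⟩⟩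
    have : 0 ≤ (i : ℤ) * d := by positivity
    linarith

theorem isAP_Icc (a b : ℤ) : IsAP (Finset.Icc a b) := by
  simpa using isAP_filter_dvd a b 1 le_rfl

namespace IsCoatomIn

variable {n : ℕ} {s c : Finset ℤ}

theorem eq_of_subset (h : IsCoatomIn n s) {y : Finset ℤ} (hy : IsAP y)
    (hyn : y ⊆ Finset.Icc (1 : ℤ) n) (hne : y ≠ Finset.Icc (1 : ℤ) n) (hsy : s ⊆ y) : s = y := by
  by_contra hsn
  exact hne (h.2.2.2 y hy hyn (lt_of_le_of_ne hsy hsn))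

theorem one_le (h : IsCoatomIn n s) : (1 : ℤ) ≤ n := by
  by_contra! hn
  have he : Finset.Icc (1 : ℤ) n = ∅ := Finset.Icc_eq_empty (by omega)
  have h1 := h.2.1
  have h2 := h.2.2.1
  rw [he] at h1 h2
  exact h2 (Finset.subset_empty.mp h1)

theorem eq_Icc_of_right_notMem (h : IsCoatomIn n s) (hs : (n : ℤ) ∉ s) :
    s = Finset.Icc 1 ((n : ℤ) - 1) := by
  have hn := h.one_le
  refine h.eq_of_subset (isAP_Icc _ _) (Finset.Icc_subset_Icc_right (by omega)) ?_ ?_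
  · intro he
    have : (n : ℤ) ∈ Finset.Icc 1 ((n : ℤ) - 1) := by
      rw [he]
      exact Finset.mem_Icc.2 ⟨hn, le_rfl⟩
    rw [Finset.mem_Icc] at this
    omega
  · intro v hv
    have h1 := Finset.mem_Icc.1 (h.2.1 hv)
    have : v ≠ n := fun e => hs (e ▸ hv)
    exact Finset.mem_Icc.2 ⟨h1.1, by omega⟩

theorem eq_Icc_of_left_notMem (h : IsCoatomIn n s) (hs : (1 : ℤ) ∉ s) :
    s = Finset.Icc 2 (n : ℤ) := by
  have hn := h.one_le
  refine h.eq_of_subset (isAP_Icc _ _) (Finset.Icc_subset_Icc_left (by omega)) ?_ ?_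
  · intro he
    have : (1 : ℤ) ∈ Finset.Icc 2 (n : ℤ) := by
      rw [he]
      exact Finset.mem_Icc.2 ⟨le_rfl, hn⟩
    rw [Finset.mem_Icc] at this
    omega
  · intro v hv
    have h1 := Finset.mem_Icc.1 (h.2.1 hv)
    have : v ≠ 1 := fun e => hs (e ▸ hv)
    exact Finset.mem_Icc.2 ⟨by omega, h1.2⟩

theorem exists_prime (h : IsCoatomIn n s) (h1 : (1 : ℤ) ∈ s) (hn : (n : ℤ) ∈ s) :
    2 ≤ n ∧ ∃ p : ℕ, p.Prime ∧ p ∣ n - 1 ∧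
      s = (Finset.Icc (1 : ℤ) n).filter (fun v => (p : ℤ) ∣ v - 1) := by
  have hn1 := h.one_le
  obtain ⟨a, r, k, hr, hs⟩ := isAP_iff.1 h.1
  have hdvd : ∀ v ∈ s, r ∣ v - 1 := by
    intro v hv
    obtain ⟨i, -, rfl⟩ := (hs v).1 hv
    obtain ⟨j, -, hj⟩ := (hs 1).1 h1
    exact ⟨i - j, by linear_combination hj⟩
  have h2 : 2 ≤ n := by
    by_contra! hlt
    obtain rfl : n = 1 := by omega
    apply h.2.2.1
    refine h.2.1.antisymm ?_
    simpa using h1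
  have hr1 : r ≠ 1 := by
    rintro rfl
    apply h.2.2.1
    refine h.2.1.antisymm fun v hv => ?_
    rw [Finset.mem_Icc] at hv
    obtain ⟨i, hi, hi'⟩ := (hs 1).1 h1
    obtain ⟨j, hj, hj'⟩ := (hs n).1 hn
    exact (hs v).2 ⟨(v - a).toNat, by omega, by omega⟩
  obtain ⟨p, hp, hpr⟩ := Nat.exists_prime_and_dvd (n := r.natAbs) (by omega)
  have hpr' : (p : ℤ) ∣ r := Int.natCast_dvd.2 hpr
  refine ⟨h2, p, hp, ?_, ?_⟩
  · have := hpr'.trans (hdvd _ hn)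
    rw [← Int.natCast_dvd_natCast]
    push_cast [show 1 ≤ n by omega]
    exact this
  · refine h.eq_of_subset (isAP_filter_dvd _ _ _ (by exact_mod_cast hp.one_le))
      (Finset.filter_subset _ _) ?_ ?_
    · intro he
      have hm : (2 : ℤ) ∈ (Finset.Icc (1 : ℤ) n).filter (fun v => (p : ℤ) ∣ v - 1) := by
        rw [he]
        exact Finset.mem_Icc.2 ⟨by omega, by omega⟩
      have h3 := (Finset.mem_filter.1 hm).2
      norm_num at h3
      exact hp.not_dvd_one (by exact_mod_cast h3)
    · intro v hv
      exact Finset.mem_filter.2 ⟨h.2.1 hv, hpr'.trans (hdvd v hv)⟩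

theorem exists_eq_filter (h : IsCoatomIn n s) :
    ∃ a b d : ℤ, 1 ≤ d ∧ s = (Finset.Icc a b).filter (fun v => d ∣ v - 1) := by
  by_cases hn : (n : ℤ) ∈ s
  · by_cases h1 : (1 : ℤ) ∈ s
    · obtain ⟨-, p, hp, -, hs⟩ := h.exists_prime h1 hn
      exact ⟨_, _, _, by exact_mod_cast hp.one_le, hs⟩
    · exact ⟨_, _, 1, le_rfl, by simpa using h.eq_Icc_of_left_notMem h1⟩
  · exact ⟨_, _, 1, le_rfl, by simpa using h.eq_Icc_of_right_notMem hn⟩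

/-- No coatom contains the intersection of all the other coatoms. -/
theorem exists_notMem_forall_mem (hc : IsCoatomIn n c) :
    ∃ v ∈ Finset.Icc (1 : ℤ) n, v ∉ c ∧ ∀ s, IsCoatomIn n s → s ≠ c → v ∈ s := by
  have hn1 := hc.one_le
  by_cases hn : (n : ℤ) ∈ c
  swap
  · refine ⟨n, Finset.mem_Icc.2 ⟨hn1, le_rfl⟩, hn, fun s hs hsc => ?_⟩
    by_contra hns
    exact hsc ((hs.eq_Icc_of_right_notMem hns).trans (hc.eq_Icc_of_right_notMem hn).symm)
  by_cases h1 : (1 : ℤ) ∈ c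
  swap
  · refine ⟨1, Finset.mem_Icc.2 ⟨le_rfl, hn1⟩, h1, fun s hs hsc => ?_⟩
    by_contra hns
    exact hsc ((hs.eq_Icc_of_left_notMem hns).trans (hc.eq_Icc_of_left_notMem h1).symm)
  obtain ⟨h2, p, hp, hpn, hcp⟩ := hc.exists_prime h1 hn
  obtain ⟨k, m, hpm, hkm⟩ := Nat.exists_eq_pow_mul_and_not_dvd (n := n - 1) (by omega) p hp.ne_one
  have hm0 : 0 < m := Nat.pos_of_ne_zero (by rintro rfl; simp at hpm)
  have hmn : m < n - 1 := by
    refine lt_of_le_of_ne (Nat.le_of_dvd (by omega) ⟨p ^ k, by rw [hkm, mul_comm]⟩) ?_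
    rintro rfl
    exact hpm hpn
  refine ⟨1 + m, Finset.mem_Icc.2 ⟨by omega, by omega⟩, ?_, fun s hs hsc => ?_⟩
  · rw [hcp, Finset.mem_filter]
    rintro ⟨-, hd⟩
    apply hpm
    rw [add_sub_cancel_left] at hd
    exact_mod_cast hd
  by_cases hns : (n : ℤ) ∈ s
  swap
  · rw [hs.eq_Icc_of_right_notMem hns]
    exact Finset.mem_Icc.2 ⟨by omega, by omega⟩
  by_cases h1s : (1 : ℤ) ∈ s
  swap
  · rw [hs.eq_Icc_of_left_notMem h1s]
    exact Finset.mem_Icc.2 ⟨by omega, by omega⟩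
  obtain ⟨-, q, hq, hqn, hsq⟩ := hs.exists_prime h1s hns
  have hqp : q ≠ p := by
    rintro rfl
    exact hsc (hsq.trans hcp.symm)
  have hqm : q ∣ m := by
    rw [hkm] at hqn
    refine (hq.dvd_mul.1 hqn).resolve_left fun hqk => hqp ?_
    exact (Nat.prime_dvd_prime_iff_eq hq hp).1 (hq.dvd_of_dvd_pow hqk)
  rw [hsq, Finset.mem_filter, add_sub_cancel_left]
  exact ⟨Finset.mem_Icc.2 ⟨by omega, by omega⟩, by exact_mod_cast hqm⟩

end IsCoatomIn

theorem apMeet_injOn_coatoms {n : ℕ} {S T : Finset (Finset ℤ)}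
    (hS : ∀ s ∈ S, IsCoatomIn n s) (hT : ∀ s ∈ T, IsCoatomIn n s)
    (h : apMeet (Finset.Icc (1 : ℤ) n) S = apMeet (Finset.Icc (1 : ℤ) n) T) : S = T := by
  have key : ∀ S T : Finset (Finset ℤ), (∀ s ∈ S, IsCoatomIn n s) → (∀ s ∈ T, IsCoatomIn n s) →
      apMeet (Finset.Icc (1 : ℤ) n) S = apMeet (Finset.Icc (1 : ℤ) n) T → S ⊆ T := by
    intro S T hS hT h c hc
    by_contra hcT
    obtain ⟨v, hv, hvc, hvs⟩ := (hS c hc).exists_notMem_forall_mem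
    have hm : v ∈ apMeet (Finset.Icc (1 : ℤ) n) T :=
      mem_apMeet.2 ⟨hv, fun s hs => hvs s (hT s hs) fun e => hcT (e ▸ hs)⟩
    rw [← h, mem_apMeet] at hm
    exact hvc (hm.2 c hc)
  exact (key S T hS hT h).antisymm (key T S hT hS h.symm)

theorem isAP_apMeet {n : ℕ} {S : Finset (Finset ℤ)} (hS : ∀ s ∈ S, IsCoatomIn n s) :
    IsAP (apMeet (Finset.Icc (1 : ℤ) n) S) := by
  suffices ∃ a b d : ℤ, 1 ≤ d ∧
      apMeet (Finset.Icc (1 : ℤ) n) S = (Finset.Icc a b).filter (fun v => d ∣ v - 1) by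
    obtain ⟨a, b, d, hd, h⟩ := this
    rw [h]
    exact isAP_filter_dvd a b d hd
  induction S using Finset.induction_on with
  | empty => exact ⟨1, n, 1, le_rfl, by simp [apMeet]⟩
  | insert c S hc ih =>
    rw [Finset.forall_mem_insert] at hS
    obtain ⟨a, b, d, hd, h⟩ := ih hS.2
    obtain ⟨a', b', d', hd', h'⟩ := hS.1.exists_eq_filter
    have hl : (0 : ℤ) < (Int.lcm d d' : ℤ) := by
      exact_mod_cast Int.lcm_pos (by omega) (by omega)
    refine ⟨max a a', min b b', Int.lcm d d', hl, ?_⟩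
    have hi : apMeet (Finset.Icc (1 : ℤ) n) (insert c S)
        = c ∩ apMeet (Finset.Icc (1 : ℤ) n) S := Finset.fold_insert hc
    rw [hi, h, h']
    ext v
    simp only [Finset.mem_inter, Finset.mem_filter, Finset.mem_Icc, max_le_iff, le_min_iff,
      Int.coe_lcm_dvd_iff]
    tauto

theorem exists_isCoatomIn_superset {n : ℕ} {x : Finset ℤ} (hx : IsAP x)
    (hxn : x ⊆ Finset.Icc (1 : ℤ) n) (hne : x ≠ Finset.Icc (1 : ℤ) n) :
    ∃ s, IsCoatomIn n s ∧ x ⊆ s := by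
  obtain ⟨s, hxs, hs⟩ := Finset.exists_le_maximal
    ((Finset.Icc (1 : ℤ) n).powerset.filter (fun y => IsAP y ∧ y ≠ Finset.Icc (1 : ℤ) n))
    (Finset.mem_filter.2 ⟨Finset.mem_powerset.2 hxn, hx, hne⟩)
  have hs' := hs.prop
  rw [Finset.mem_filter, Finset.mem_powerset] at hs'
  refine ⟨s, ⟨hs'.2.1, hs'.1, hs'.2.2, fun y hy hyn hsy => ?_⟩, hxs⟩
  by_contra hyne
  exact hs.not_gt (Finset.mem_filter.2 ⟨Finset.mem_powerset.2 hyn, hy, hyne⟩) hsy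

theorem sum_apMu {x y : Finset ℤ} (hx : IsAP x) (hy : IsAP y) :
    ∑ w ∈ y.powerset.filter (fun w => IsAP w ∧ x ⊆ w), apMu x w = if x = y then 1 else 0 := by
  split_ifs with h
  · subst h
    have : x.powerset.filter (fun w => IsAP w ∧ x ⊆ w) = {x} := by
      ext w
      simp only [Finset.mem_filter, Finset.mem_powerset, Finset.mem_singleton]
      exact ⟨fun h => h.1.antisymm h.2.2, by rintro rfl; exact ⟨subset_rfl, hx, subset_rfl⟩⟩
    rw [this, Finset.sum_singleton, apMu, if_pos rfl]
  · by_cases hxy : x ⊆ y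
    · have : y.powerset.filter (fun w => IsAP w ∧ x ⊆ w)
          = insert y (y.powerset.filter (fun w => IsAP w ∧ x ⊆ w ∧ w ≠ y)) := by
        ext w
        simp only [Finset.mem_filter, Finset.mem_powerset, Finset.mem_insert]
        by_cases hw : w = y
        · subst hw
          simp [hy, hxy]
        · simp [hw]
      rw [this, Finset.sum_insert (by simp)]
      conv_lhs => enter [1]; rw [apMu]
      rw [if_neg h, Finset.sum_attach _ (fun z => apMu x z), neg_add_cancel]
    · refine Finset.sum_eq_zero fun w hw => ?_
      rw [Finset.mem_filter, Finset.mem_powerset] at hw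
      exact absurd (hw.2.2.trans hw.1) hxy

/-- The coatom version of the crosscut theorem for the lattice of arithmetic progressions. -/
theorem apMu_eq_sum_coatoms {n : ℕ} {x : Finset ℤ} (hx : IsAP x)
    (hxn : x ⊆ Finset.Icc (1 : ℤ) n) :
    apMu x (Finset.Icc (1 : ℤ) n) =
      ∑ S ∈ ((Finset.Icc (1 : ℤ) n).powerset.filter (IsCoatomIn n)).powerset,
        if x = apMeet (Finset.Icc (1 : ℤ) n) S then (-1 : ℤ) ^ S.card else 0 := by
  set t := Finset.Icc (1 : ℤ) n
  set A := t.powerset.filter (IsCoatomIn n)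
  set L := t.powerset.filter (fun w => IsAP w ∧ x ⊆ w) with hL
  have inner : ∀ S ∈ A.powerset, (if x = apMeet t S then (-1 : ℤ) ^ S.card else 0)
      = ∑ w ∈ L, if w ⊆ apMeet t S then (-1 : ℤ) ^ S.card * apMu x w else 0 := by
    intro S hS
    have hSc : ∀ s ∈ S, IsCoatomIn n s := fun s hs =>
      (Finset.mem_filter.1 (Finset.mem_powerset.1 hS hs)).2
    have hf : L.filter (fun w => w ⊆ apMeet t S)
        = (apMeet t S).powerset.filter (fun w => IsAP w ∧ x ⊆ w) := by
      ext w
      simp only [hL, Finset.mem_filter, Finset.mem_powerset]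
      have : w ⊆ apMeet t S → w ⊆ t := fun h => (subset_apMeet.1 h).1
      tauto
    rw [← Finset.sum_filter, hf, ← Finset.mul_sum, sum_apMu hx (isAP_apMeet hSc),
      mul_ite, mul_one, mul_zero]
  rw [Finset.sum_congr rfl inner, Finset.sum_comm]
  have outer : ∀ w ∈ L, (∑ S ∈ A.powerset,
      if w ⊆ apMeet t S then (-1 : ℤ) ^ S.card * apMu x w else 0)
      = if w = t then apMu x w else 0 := by
    intro w hw
    simp only [hL, Finset.mem_filter, Finset.mem_powerset] at hw
    have hf : A.powerset.filter (fun S => w ⊆ apMeet t S)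
        = (A.filter (fun s => w ⊆ s)).powerset := by
      ext S
      simp only [Finset.mem_filter, Finset.mem_powerset, subset_apMeet, hw.1, true_and,
        Finset.subset_iff (s₁ := S)]
      grind
    rw [← Finset.sum_filter, hf, ← Finset.sum_mul, Finset.sum_powerset_neg_one_pow_card]
    have he : A.filter (fun s => w ⊆ s) = ∅ ↔ w = t := by
      constructor
      · intro h
        by_contra hwt
        obtain ⟨s, hs, hws⟩ := exists_isCoatomIn_superset hw.2.1 hw.1 hwt
        have : s ∈ A.filter (fun s => w ⊆ s) :=
          Finset.mem_filter.2 ⟨Finset.mem_filter.2 ⟨Finset.mem_powerset.2 hs.2.1, hs⟩, hws⟩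
        simp [h] at this
      · rintro rfl
        refine Finset.filter_eq_empty_iff.2 fun s hs hws => ?_
        have hs' := (Finset.mem_filter.1 hs).2
        exact hs'.2.2.1 (hs'.2.1.antisymm hws)
    simp only [he]
    split_ifs <;> simp
  rw [Finset.sum_congr rfl outer, Finset.sum_ite_eq' L t]
  rw [if_pos]
  exact Finset.mem_filter.2 ⟨Finset.mem_powerset_self t, isAP_Icc _ _, hxn⟩

/-- For `x ∈ L_n` with `x ≠ [n]`: if `x` is the meet of a subset `S` of coatoms of
`L_n` then `μ_{L_n}(x, [n]) = (-1)^{|S|}`, and if `x` is not a meet of coatoms then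
`μ_{L_n}(x, [n]) = 0`. -/
theorem mobius_via_coatoms (n : ℕ) (x : Finset ℤ) (hx : IsAP x)
    (hxn : x ⊆ Finset.Icc (1:ℤ) (n:ℤ)) (hne : x ≠ Finset.Icc (1:ℤ) (n:ℤ)) :
    (∀ S : Finset (Finset ℤ), (∀ s ∈ S, IsCoatomIn n s) →
        apMeet (Finset.Icc (1:ℤ) (n:ℤ)) S = x →
        apMu x (Finset.Icc (1:ℤ) (n:ℤ)) = (-1)^S.card) ∧
    ((¬ ∃ S : Finset (Finset ℤ), (∀ s ∈ S, IsCoatomIn n s) ∧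
          apMeet (Finset.Icc (1:ℤ) (n:ℤ)) S = x) →
        apMu x (Finset.Icc (1:ℤ) (n:ℤ)) = 0) := by
  rw [apMu_eq_sum_coatoms hx hxn]
  constructor
  · intro S hS hSx
    rw [Finset.sum_eq_single S, if_pos hSx.symm]
    · intro T hT hTS
      refine if_neg fun hTx => hTS ?_
      refine apMeet_injOn_coatoms (fun s hs => ?_) hS (hTx.symm.trans hSx.symm)
      exact (Finset.mem_filter.1 (Finset.mem_powerset.1 hT hs)).2
    · intro h
      refine absurd (Finset.mem_powerset.2 fun s hs => ?_) h
      exact Finset.mem_filter.2 ⟨Finset.mem_powerset.2 (hS s hs).2.1, hS s hs⟩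
  · intro h
    refine Finset.sum_eq_zero fun S hS => if_neg fun hSx => h ⟨S, fun s hs => ?_, hSx.symm⟩
    exact (Finset.mem_filter.1 (Finset.mem_powerset.1 hS hs)).2
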